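/- Every λ-term typable in system 𝒟 is strongly normalizing for the combined reduction by β, δ, γ and assoc. -/

import Mathlib

/-- Untyped λ-terms in de Bruijn representation. -/
inductive Lam : Type
  | var : ℕ → Lam
  | lam : Lam → Lam
  | app : Lam → Lam → Lam

namespace Lam

/-- Renaming of de Bruijn indices (extended under binders). -/
def rename (f : ℕ → ℕ) : Lam → Lam
  | var n => var (f n)
  | lam b => lam (rename (fun n => match n with | 0 => 0 | m+1 => f m + 1) b)
  | app a b => app (rename f a) (rename f b)

/-- Shift all free indices up by one. -/
def shift : Lam → Lam := rename Nat.succ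

/-- Swap the two innermost free indices. -/
def swap01 : Lam → Lam := rename (fun n => match n with | 0 => 1 | 1 => 0 | m => m)

/-- Capture-avoiding substitution of `u` for the free variable (index) `k`. -/
def subst : Lam → ℕ → Lam → Lam
  | var n, k, u => if n = k then u else if k < n then var (n-1) else var n
  | lam b, k, u => lam (subst b (k+1) (shift u))
  | app a b, k, u => app (subst a k u) (subst b k u)

/-- The names of the four reduction rules. -/
inductive Rule | beta | delta | gamma | assoc

/-- One-step reduction by a given rule, closed under all term contexts.
β : (λx.M) N ▷ M[x:=N]
δ : (λy.λx.M) N ▷ λx.((λy.M) N)   (x ∉ FV N)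
γ : ((λx.M) N) P ▷ (λx.(M P)) N   (x ∉ FV P)
assoc : M ((λx.N) P) ▷ (λx.(M N)) P   (x ∉ FV M) -/
inductive StepR : Rule → Lam → Lam → Prop
  | beta (M N) : StepR .beta (app (lam M) N) (subst M 0 N)
  | delta (M N) : StepR .delta (app (lam (lam M)) N) (lam (app (lam (swap01 M)) (shift N)))
  | gamma (M N P) : StepR .gamma (app (app (lam M) N) P) (app (lam (app M (shift P))) N)
  | assoc (M N P) : StepR .assoc (app M (app (lam N) P)) (app (lam (app (shift M) N)) P)
  | appL {r M M'} (N) : StepR r M M' → StepR r (app M N) (app M' N)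
  | appR {r N N'} (M) : StepR r N N' → StepR r (app M N) (app M N')
  | under {r M M'} : StepR r M M' → StepR r (lam M) (lam M')

/-- One-step reduction by any of β, δ, γ, assoc. -/
def Step (t t' : Lam) : Prop := ∃ r, StepR r t t'

/-- One-step β-reduction alone. -/
def StepBeta : Lam → Lam → Prop := StepR Rule.beta

/-- `t` is strongly normalizing for the reduction relation `R`:
every `R`-reduction sequence from `t` is finite. -/
def SN (R : Lam → Lam → Prop) (t : Lam) : Prop := Acc (fun a b => R b a) t

/-- Left-nested application `(H M₁ … Mₙ)`. -/
def apps : Lam → List Lam → Lam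
  | H, [] => H
  | H, M :: Ms => apps (app H M) Ms

/-- Types of system 𝒟 : atoms, arrow and intersection. -/
inductive Ty : Type
  | atom : ℕ → Ty
  | arrow : Ty → Ty → Ty
  | inter : Ty → Ty → Ty

/-- Typing judgment of system 𝒟 (contexts are lists of types, de Bruijn style). -/
inductive Typed : List Ty → Lam → Ty → Prop
  | var {Γ n A} : Γ[n]? = some A → Typed Γ (var n) A
  | app {Γ M N A B} : Typed Γ M (.arrow A B) → Typed Γ N A → Typed Γ (app M N) B
  | lam {Γ M A B} : Typed (A :: Γ) M B → Typed Γ (lam M) (.arrow A B)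
  | interI {Γ M A B} : Typed Γ M A → Typed Γ M B → Typed Γ M (.inter A B)
  | interE1 {Γ M A B} : Typed Γ M (.inter A B) → Typed Γ M A
  | interE2 {Γ M A B} : Typed Γ M (.inter A B) → Typed Γ M B

/-- A term is typable in system 𝒟 if it has a type in some context. -/
def Typable (t : Lam) : Prop := ∃ Γ A, Typed Γ t A

/-! ### Parallel substitution -/

/-- Extension of a renaming under a binder. -/
def upRen (f : ℕ → ℕ) : ℕ → ℕ
  | 0 => 0
  | m + 1 => f m + 1

theorem rename_lam (f : ℕ → ℕ) (b : Lam) : rename f (lam b) = lam (rename (upRen f) b) := by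
  have h : (fun n => match n with | 0 => 0 | m + 1 => f m + 1 : ℕ → ℕ) = upRen f := by
    funext n; cases n <;> rfl
  rw [← h]; rfl

/-- Prepend a term to a parallel substitution. -/
def scons (u : Lam) (σ : ℕ → Lam) : ℕ → Lam
  | 0 => u
  | n + 1 => σ n

/-- Extension of a parallel substitution under a binder. -/
def up (σ : ℕ → Lam) : ℕ → Lam := scons (var 0) (fun n => shift (σ n))

/-- Parallel substitution. -/
def psubst (σ : ℕ → Lam) : Lam → Lam
  | var n => σ n
  | lam b => lam (psubst (up σ) b)
  | app a b => app (psubst σ a) (psubst σ b)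

theorem subst_eq_psubst (t : Lam) : ∀ (k : ℕ) (u : Lam), subst t k u =
    psubst (fun n => if n = k then u else if k < n then var (n - 1) else var n) t := by
  induction t with
  | var n => intro k u; rfl
  | app a b iha ihb => intro k u; simp only [subst, psubst, iha, ihb]
  | lam b ih =>
    intro k u
    simp only [subst, psubst, ih]
    congr 2
    funext n
    rcases n with _ | n
    · simp [up, scons]
    · simp only [up, scons]
      by_cases h : n = k
      · simp [h]
      · by_cases h' : k < n
        · have : n - 1 + 1 = n := by omega
          simp [h, h', shift, rename, this]
        · simp [h, h', shift, rename]

theorem subst_zero_eq (t u : Lam) : subst t 0 u = psubst (scons u var) t := by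
  rw [subst_eq_psubst]
  congr 1
  funext n
  cases n <;> simp [scons]

theorem psubst_rename (t : Lam) : ∀ (f : ℕ → ℕ) (σ : ℕ → Lam),
    psubst σ (rename f t) = psubst (fun n => σ (f n)) t := by
  induction t with
  | var n => intro f σ; rfl
  | app a b iha ihb => intro f σ; simp only [rename, psubst, iha, ihb]
  | lam b ih =>
    intro f σ
    rw [rename_lam]
    simp only [psubst, ih]
    congr 2
    funext n
    cases n <;> rfl

theorem rename_rename (t : Lam) : ∀ f g : ℕ → ℕ,
    rename f (rename g t) = rename (fun n => f (g n)) t := by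
  induction t with
  | var n => intro f g; rfl
  | app a b iha ihb => intro f g; simp only [rename, iha, ihb]
  | lam b ih =>
    intro f g
    simp only [rename_lam, ih]
    congr 2
    funext n
    cases n <;> rfl

theorem rename_psubst (t : Lam) : ∀ (f : ℕ → ℕ) (σ : ℕ → Lam),
    rename f (psubst σ t) = psubst (fun n => rename f (σ n)) t := by
  induction t with
  | var n => intro f σ; rfl
  | app a b iha ihb => intro f σ; simp only [rename, psubst, iha, ihb]
  | lam b ih =>
    intro f σ
    simp only [psubst, rename_lam, ih]
    congr 2
    funext n
    cases n with
    | zero => rfl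
    | succ n => simp only [up, scons, shift, rename_rename, upRen]

theorem psubst_psubst (t : Lam) : ∀ σ τ : ℕ → Lam,
    psubst τ (psubst σ t) = psubst (fun n => psubst τ (σ n)) t := by
  induction t with
  | var n => intro σ τ; rfl
  | app a b iha ihb => intro σ τ; simp only [psubst, iha, ihb]
  | lam b ih =>
    intro σ τ
    simp only [psubst, ih]
    congr 2
    funext n
    cases n with
    | zero => rfl
    | succ n => simp only [up, scons, shift, rename_psubst, psubst_rename]

theorem psubst_var (t : Lam) : psubst var t = t := by
  induction t with
  | var n => rfl
  | app a b iha ihb => simp only [psubst, iha, ihb]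
  | lam b ih =>
    have h : up var = var := by funext n; cases n <;> rfl
    simp only [psubst, h, ih]

theorem subst_psubst_up (t u : Lam) (σ : ℕ → Lam) :
    subst (psubst (up σ) t) 0 u = psubst (scons u σ) t := by
  rw [subst_zero_eq, psubst_psubst]
  congr 1
  funext n
  cases n with
  | zero => rfl
  | succ n =>
    simp only [up, scons, shift, psubst_rename]
    exact psubst_var _

/-! ### Weighted intersection types -/

/-- Weighted types: the domain of an arrow is a finite list of types, each with a bound on the
weight of the argument at that type. -/
inductive WTy : Type
  | atom : WTy
  | arrow : List (WTy × ℕ) → WTy → WTy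

/-- Contexts of weighted types: a set of weighted types for each variable. -/
abbrev WCtx : Type := ℕ → Set (WTy × ℕ)

/-- Extend a context with an assignment for a new innermost variable. -/
def WCtx.cons (L : List (WTy × ℕ)) (Γ : WCtx) : WCtx
  | 0 => {p | p ∈ L}
  | n + 1 => Γ n

/-- `WTypedAll P L s`: the predicate `P` holds at each member of `L` within the prescribed weight,
and at one further type, with total weight at most `s`. -/
def WTypedAll (P : WTy → ℕ → Prop) : List (WTy × ℕ) → ℕ → Prop
  | [], s => ∃ A, P A s
  | (A, w) :: L, s => ∃ k r, k ≤ w ∧ P A k ∧ WTypedAll P L r ∧ k + r ≤ s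

/-- `WTyped t Γ A n`: the term `t` has type `A` in context `Γ` with weight at most `n`. -/
def WTyped : Lam → WCtx → WTy → ℕ → Prop
  | var k, Γ, A, n => ∃ w ≤ n, (A, w) ∈ Γ k
  | lam M, Γ, A, n => ∃ L B, A = .arrow L B ∧ WTyped M (Γ.cons L) B n
  | app M N, Γ, A, n => ∃ L m s, WTyped M Γ (.arrow L A) m ∧
      WTypedAll (fun B k => WTyped N Γ B k) L s ∧ m + s + 1 ≤ n

theorem WTypedAll.imp {P P' : WTy → ℕ → Prop} (h : ∀ A k, P A k → P' A k)
    {L : List (WTy × ℕ)} : ∀ {s : ℕ}, WTypedAll P L s → WTypedAll P' L s := by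
  induction L with
  | nil => rintro s ⟨A, hA⟩; exact ⟨A, h _ _ hA⟩
  | cons p L ih =>
    rintro s ⟨k, r, hk, hP, hL, hs⟩
    exact ⟨k, r, hk, h _ _ hP, ih hL, hs⟩

theorem WTypedAll.mono {P : WTy → ℕ → Prop} (h : ∀ A k k', P A k → k ≤ k' → P A k')
    {L : List (WTy × ℕ)} {s s' : ℕ} (hL : WTypedAll P L s) (hs : s ≤ s') :
    WTypedAll P L s' := by
  cases L with
  | nil => obtain ⟨A, hA⟩ := hL; exact ⟨A, h _ _ _ hA hs⟩
  | cons p L =>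
    obtain ⟨k, r, hk, hP, hL, hr⟩ := hL
    exact ⟨k, r, hk, hP, hL, hr.trans hs⟩

theorem WTypedAll.append {P : WTy → ℕ → Prop} (h : ∀ A k k', P A k → k ≤ k' → P A k')
    {L L' : List (WTy × ℕ)} {s' : ℕ} (hL' : WTypedAll P L' s') :
    ∀ {s : ℕ}, WTypedAll P L s → WTypedAll P (L ++ L') (s + s') := by
  induction L with
  | nil => intro s _; exact hL'.mono h (Nat.le_add_left _ _)
  | cons p L ih =>
    rintro s ⟨k, r, hk, hP, hL, hr⟩
    exact ⟨k, r + s', hk, hP, ih hL, by omega⟩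

theorem WTypedAll.lt {P P' : WTy → ℕ → Prop} (h : ∀ A k, P A k → ∃ k' < k, P' A k')
    {L : List (WTy × ℕ)} :
    ∀ {s : ℕ}, WTypedAll P L s → ∃ s' < s, WTypedAll P' L s' := by
  induction L with
  | nil =>
    rintro s ⟨A, hA⟩
    obtain ⟨s', hs', h'⟩ := h _ _ hA
    exact ⟨s', hs', A, h'⟩
  | cons p L ih =>
    rintro s ⟨k, r, hk, hP, hL, hr⟩
    obtain ⟨k', hk', hP'⟩ := h _ _ hP
    obtain ⟨r', hr', hL'⟩ := ih hL
    exact ⟨k' + r', by omega, k', r', by omega, hP', hL', le_rfl⟩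

theorem WTypedAll.mem {P : WTy → ℕ → Prop} (h : ∀ A k k', P A k → k ≤ k' → P A k')
    {L : List (WTy × ℕ)} : ∀ {s : ℕ}, WTypedAll P L s → ∀ p ∈ L, P p.1 p.2 := by
  induction L with
  | nil => simp
  | cons q L ih =>
    rintro s ⟨k, r, hk, hP, hL, -⟩ p hp
    rcases List.mem_cons.1 hp with rfl | hp
    · exact h _ _ _ hP hk
    · exact ih hL p hp

theorem WTypedAll.exists_of_forall {P : WTy → ℕ → Prop} {A : WTy} {k : ℕ} (hA : P A k)
    {L : List (WTy × ℕ)} (h : ∀ p ∈ L, P p.1 p.2) : ∃ s, WTypedAll P L s := by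
  induction L with
  | nil => exact ⟨k, A, hA⟩
  | cons q L ih =>
    obtain ⟨s, hs⟩ := ih fun p hp => h p (List.mem_cons_of_mem _ hp)
    exact ⟨q.2 + s, q.2, s, le_rfl, h q List.mem_cons_self, hs, le_rfl⟩

/-- Inclusion of contexts up to increasing the weights. -/
def WCtx.Sub (Γ Δ : WCtx) : Prop := ∀ i A w, (A, w) ∈ Γ i → ∃ w' ≤ w, (A, w') ∈ Δ i

theorem WCtx.Sub.of_subset {Γ Δ : WCtx} (h : ∀ i, Γ i ⊆ Δ i) : Γ.Sub Δ :=
  fun i _ w hw => ⟨w, le_rfl, h i hw⟩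

theorem WCtx.Sub.cons {Γ Δ : WCtx} (h : Γ.Sub Δ) (L : List (WTy × ℕ)) :
    (Γ.cons L).Sub (Δ.cons L) := by
  intro i A w hw
  cases i with
  | zero => exact ⟨w, le_rfl, hw⟩
  | succ i => exact h i A w hw

theorem WTyped.weaken {t : Lam} : ∀ {Γ Δ : WCtx} {A : WTy} {n : ℕ}, Γ.Sub Δ →
    WTyped t Γ A n → WTyped t Δ A n := by
  induction t with
  | var k =>
    rintro Γ Δ A n h ⟨w, hw, hm⟩
    obtain ⟨w', hw', hm'⟩ := h _ _ _ hm
    exact ⟨w', hw'.trans hw, hm'⟩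
  | lam b ih =>
    rintro Γ Δ A n h ⟨L, B, hA, hb⟩
    exact ⟨L, B, hA, ih (h.cons L) hb⟩
  | app a b iha ihb =>
    rintro Γ Δ A n h ⟨L, m, s, ha, hb, hn⟩
    exact ⟨L, m, s, iha h ha, hb.imp fun _ _ => ihb h, hn⟩

theorem WTyped.mono {t : Lam} : ∀ {Γ : WCtx} {A : WTy} {n n' : ℕ},
    WTyped t Γ A n → n ≤ n' → WTyped t Γ A n' := by
  induction t with
  | var k => rintro Γ A n n' ⟨w, hw, hm⟩ h; exact ⟨w, hw.trans h, hm⟩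
  | lam b ih => rintro Γ A n n' ⟨L, B, hA, hb⟩ h; exact ⟨L, B, hA, ih hb h⟩
  | app a b _ _ =>
    rintro Γ A n n' ⟨L, m, s, ha, hb, hn⟩ h
    exact ⟨L, m, s, ha, hb, hn.trans h⟩

theorem wTyped_rename {t : Lam} : ∀ {f : ℕ → ℕ} {Γ : WCtx} {A : WTy} {n : ℕ},
    WTyped (rename f t) Γ A n ↔ WTyped t (fun i => Γ (f i)) A n := by
  induction t with
  | var k => intro f Γ A n; rfl
  | lam b ih =>
    intro f Γ A n
    have h : ∀ L, (fun i => WCtx.cons L Γ (upRen f i)) = WCtx.cons L (fun i => Γ (f i)) := by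
      intro L; funext i; cases i <;> rfl
    simp only [rename_lam, WTyped, ih, h]
  | app a b iha ihb => intro f Γ A n; simp only [rename, WTyped, iha, ihb]

theorem wTyped_shift {t : Lam} {L : List (WTy × ℕ)} {Γ : WCtx} {A : WTy} {n : ℕ} :
    WTyped (shift t) (Γ.cons L) A n ↔ WTyped t Γ A n := wTyped_rename

/-- The context of all weighted types of the terms of a substitution. -/
def WCtx.ofSubst (σ : ℕ → Lam) (Δ : WCtx) : WCtx := fun i => {p | WTyped (σ i) Δ p.1 p.2}

theorem wTyped_psubst {t : Lam} : ∀ {σ : ℕ → Lam} {Δ : WCtx} {A : WTy} {n : ℕ},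
    WTyped (psubst σ t) Δ A n ↔ WTyped t (WCtx.ofSubst σ Δ) A n := by
  induction t with
  | var k =>
    intro σ Δ A n
    exact ⟨fun h => ⟨n, le_rfl, h⟩, fun ⟨_, hw, h⟩ => WTyped.mono h hw⟩
  | app a b iha ihb => intro σ Δ A n; simp only [psubst, WTyped, iha, ihb]
  | lam b ih =>
    intro σ Δ A n
    have h₁ : ∀ L, (WCtx.ofSubst (up σ) (Δ.cons L)).Sub ((WCtx.ofSubst σ Δ).cons L) := by
      intro L i B w hw
      cases i with
      | zero => exact hw
      | succ i => exact ⟨w, le_rfl, wTyped_shift.1 hw⟩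
    have h₂ : ∀ L, ((WCtx.ofSubst σ Δ).cons L).Sub (WCtx.ofSubst (up σ) (Δ.cons L)) := by
      intro L i B w hw
      cases i with
      | zero => exact ⟨w, le_rfl, w, le_rfl, hw⟩
      | succ i => exact ⟨w, le_rfl, wTyped_shift.2 hw⟩
    simp only [psubst, WTyped, ih]
    exact ⟨fun ⟨L, B, hA, hb⟩ => ⟨L, B, hA, hb.weaken (h₁ L)⟩,
      fun ⟨L, B, hA, hb⟩ => ⟨L, B, hA, hb.weaken (h₂ L)⟩⟩

/-- A derivation uses only finitely many types for each variable. -/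
theorem WTyped.exists_finite {t : Lam} : ∀ {Γ : WCtx} {A : WTy} {n : ℕ}, WTyped t Γ A n →
    ∃ Δ : ℕ → List (WTy × ℕ), (∀ i, ∀ p ∈ Δ i, p ∈ Γ i) ∧
      WTyped t (fun i => {p | p ∈ Δ i}) A n := by
  induction t with
  | var k =>
    rintro Γ A n ⟨w, hw, hm⟩
    refine ⟨fun i => if i = k then [(A, w)] else [], fun i p hp => ?_, w, hw, by simp⟩
    by_cases h : i = k
    · subst h
      simp only [if_true, List.mem_singleton] at hp
      exact hp ▸ hm
    · simp [h] at hp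
  | lam b ih =>
    rintro Γ A n ⟨L, B, hA, hb⟩
    obtain ⟨Δ, hΔ, hb'⟩ := ih hb
    refine ⟨fun i => Δ (i + 1), fun i => hΔ (i + 1), L, B, hA, hb'.weaken ?_⟩
    refine .of_subset fun i => ?_
    cases i with
    | zero => exact hΔ 0
    | succ i => exact subset_rfl
  | app a b iha ihb =>
    have hall : ∀ (Γ : WCtx) (L : List (WTy × ℕ)) (s : ℕ),
        WTypedAll (fun B k => WTyped b Γ B k) L s →
        ∃ Δ : ℕ → List (WTy × ℕ), (∀ i, ∀ p ∈ Δ i, p ∈ Γ i) ∧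
          WTypedAll (fun B k => WTyped b (fun i => {p | p ∈ Δ i}) B k) L s := by
      intro Γ L
      induction L with
      | nil =>
        rintro s ⟨B, hB⟩
        obtain ⟨Δ, hΔ, hB'⟩ := ihb hB
        exact ⟨Δ, hΔ, B, hB'⟩
      | cons q L ih =>
        rintro s ⟨k, r, hk, hP, hL, hs⟩
        obtain ⟨Δ₁, h₁, hP'⟩ := ihb hP
        obtain ⟨Δ₂, h₂, hL'⟩ := ih _ hL
        refine ⟨fun i => Δ₁ i ++ Δ₂ i, fun i p hp => ?_, k, r, hk,
          hP'.weaken (.of_subset fun i p hp => List.mem_append_left _ hp),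
          hL'.imp fun _ _ => WTyped.weaken (.of_subset fun i p hp => List.mem_append_right _ hp),
          hs⟩
        exact (List.mem_append.1 hp).elim (h₁ i p) (h₂ i p)
    rintro Γ A n ⟨L, m, s, ha, hb, hn⟩
    obtain ⟨Δ₁, h₁, ha'⟩ := iha ha
    obtain ⟨Δ₂, h₂, hb'⟩ := hall _ _ _ hb
    refine ⟨fun i => Δ₁ i ++ Δ₂ i, fun i p hp => ?_, L, m, s,
      ha'.weaken (.of_subset fun i p hp => List.mem_append_left _ hp),
      hb'.imp fun _ _ => WTyped.weaken (.of_subset fun i p hp => List.mem_append_right _ hp),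
      hn⟩
    exact (List.mem_append.1 hp).elim (h₁ i p) (h₂ i p)

/-- Subject reduction for the substitution of an argument. -/
theorem WTyped.subst {M N : Lam} {L : List (WTy × ℕ)} {Γ : WCtx} {A : WTy} {n : ℕ}
    (hM : WTyped M (Γ.cons L) A n) (hN : ∀ p ∈ L, WTyped N Γ p.1 p.2) :
    WTyped (Lam.subst M 0 N) Γ A n := by
  rw [subst_zero_eq, wTyped_psubst]
  refine hM.weaken (.of_subset fun i => ?_)
  cases i with
  | zero => exact fun p hp => hN p hp
  | succ i => exact fun p hp => ⟨p.2, le_rfl, hp⟩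

/-- Subject expansion for β, provided that the argument is typable. -/
theorem WTyped.expand {M N : Lam} {Γ : WCtx} {A B : WTy} {n k : ℕ}
    (h : WTyped (Lam.subst M 0 N) Γ A n) (hN : WTyped N Γ B k) :
    ∃ n', WTyped (app (lam M) N) Γ A n' := by
  rw [subst_zero_eq, wTyped_psubst] at h
  obtain ⟨Δ, hΔ, hM⟩ := h.exists_finite
  obtain ⟨s, hs⟩ := WTypedAll.exists_of_forall (P := fun B k => WTyped N Γ B k) hN (hΔ 0)
  refine ⟨n + s + 1, Δ 0, n, s, ⟨_, _, rfl, hM.weaken fun i C w hw => ?_⟩, hs, le_rfl⟩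
  cases i with
  | zero => exact ⟨w, le_rfl, hw⟩
  | succ i => exact hΔ (i + 1) _ hw

/-! ### Behaviour of the weights under reduction -/

/-- Factor out of a family of typings of `(λx.N) P` a single list of types for `x`. -/
theorem WTypedAll.of_redex {N P : Lam} {Γ : WCtx} {K : List (WTy × ℕ)} : ∀ {s : ℕ},
    WTypedAll (fun B k => WTyped (Lam.app (Lam.lam N) P) Γ B k) K s →
    ∃ L a b, WTypedAll (fun B k => WTyped N (Γ.cons L) B k) K a ∧
      WTypedAll (fun B k => WTyped P Γ B k) L b ∧ a + b + 1 ≤ s := by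
  induction K with
  | nil =>
    rintro s ⟨B, L, m, r, ⟨_, _, h, hN⟩, hP, hs⟩
    cases h
    exact ⟨L, m, r, ⟨B, hN⟩, hP, hs⟩
  | cons q K ih =>
    rintro s ⟨k, r, hk, ⟨L₁, m, b₁, ⟨_, _, h, hN⟩, hP, hm⟩, hK, hs⟩
    cases h
    obtain ⟨L₂, a, b₂, hK', hP', hr⟩ := ih hK
    refine ⟨L₁ ++ L₂, m + a, b₁ + b₂, ⟨m, a, by omega, hN.weaken ?_,
      hK'.imp fun _ _ => WTyped.weaken ?_, le_rfl⟩,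
      hP'.append (P := fun B k => WTyped P Γ B k) (fun _ _ _ => WTyped.mono) hP, by omega⟩
    · refine .of_subset fun i p hp => ?_
      cases i with
      | zero => exact List.mem_append_left _ hp
      | succ i => exact hp
    · refine .of_subset fun i p hp => ?_
      cases i with
      | zero => exact List.mem_append_right _ hp
      | succ i => exact hp

/-- The permutation rules do not increase weights. -/
theorem StepR.wTyped_of_ne_beta {r : Rule} {t t' : Lam} (hst : StepR r t t') (hr : r ≠ .beta) :
    ∀ {Γ : WCtx} {A : WTy} {n : ℕ}, WTyped t Γ A n → WTyped t' Γ A n := by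
  induction hst with
  | beta M N => exact absurd rfl hr
  | delta M N =>
    rintro Γ A n ⟨L, m, s, ⟨_, _, h, K, C, hC, hM⟩, hN, hn⟩
    cases h
    refine ⟨K, C, hC, L, m, s, ⟨L, C, rfl, ?_⟩, hN.imp fun _ _ => wTyped_shift.2, hn⟩
    refine wTyped_rename.2 (hM.weaken (.of_subset fun i => ?_))
    rcases i with _ | _ | i <;> exact subset_rfl
  | gamma M N P =>
    rintro Γ A n ⟨L, m, s, ⟨K, m', s', ⟨_, _, h, hM⟩, hN, hm⟩, hP, hn⟩
    cases h
    exact ⟨K, m' + s + 1, s', ⟨_, _, rfl, L, m', s, hM, hP.imp fun _ _ => wTyped_shift.2,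
      le_rfl⟩, hN, by omega⟩
  | assoc M N P =>
    rintro Γ A n ⟨K, m, s, hM, hNP, hn⟩
    obtain ⟨L, a, b, hN, hP, hs⟩ := hNP.of_redex
    exact ⟨L, m + a + 1, b, ⟨_, _, rfl, K, m, a, wTyped_shift.2 hM, hN, le_rfl⟩, hP, by omega⟩
  | appL N _ ih =>
    rintro Γ A n ⟨L, m, s, hM, hN, hn⟩
    exact ⟨L, m, s, ih hr hM, hN, hn⟩
  | appR M _ ih =>
    rintro Γ A n ⟨L, m, s, hM, hN, hn⟩
    exact ⟨L, m, s, hM, hN.imp fun _ _ => ih hr, hn⟩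
  | under _ ih =>
    rintro Γ A n ⟨L, B, hA, hM⟩
    exact ⟨L, B, hA, ih hr hM⟩

/-- The rule β strictly decreases weights. -/
theorem StepR.exists_wTyped_lt {r : Rule} {t t' : Lam} (hst : StepR r t t') (hr : r = .beta) :
    ∀ {Γ : WCtx} {A : WTy} {n : ℕ}, WTyped t Γ A n → ∃ n' < n, WTyped t' Γ A n' := by
  induction hst with
  | beta M N =>
    rintro Γ A n ⟨L, m, s, ⟨_, _, h, hM⟩, hN, hn⟩
    cases h
    exact ⟨m, by omega, hM.subst (hN.mem (P := fun B k => WTyped N Γ B k) fun _ _ _ => WTyped.mono)⟩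
  | delta M N => cases hr
  | gamma M N P => cases hr
  | assoc M N P => cases hr
  | appL N _ ih =>
    rintro Γ A n ⟨L, m, s, hM, hN, hn⟩
    obtain ⟨m', hm', hM'⟩ := ih hr hM
    exact ⟨m' + s + 1, by omega, L, m', s, hM', hN, le_rfl⟩
  | @appR _ N N' M _ ih =>
    rintro Γ A n ⟨L, m, s, hM, hN, hn⟩
    obtain ⟨s', hs', hN'⟩ := hN.lt (P := fun B k => WTyped N Γ B k)
      (P' := fun B k => WTyped N' Γ B k) fun _ _ => ih hr
    exact ⟨m + s' + 1, by omega, L, m, s', hM, hN', le_rfl⟩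
  | under _ ih =>
    rintro Γ A n ⟨L, B, hA, hM⟩
    obtain ⟨n', hn', hM'⟩ := ih hr hM
    exact ⟨n', hn', L, B, hA, hM'⟩

/-- A measure that is strictly decreased by the permutation rules. -/
def permSize : Lam → ℕ
  | var _ => 2
  | lam b => permSize b + 1
  | app a b => permSize a * permSize b

theorem two_le_permSize (t : Lam) : 2 ≤ permSize t := by
  induction t with
  | var n => exact le_rfl
  | lam b ih => simp only [permSize]; omega
  | app a b iha ihb => simp only [permSize]; nlinarith

theorem permSize_rename (t : Lam) : ∀ f : ℕ → ℕ, permSize (rename f t) = permSize t := by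
  induction t with
  | var n => intro f; rfl
  | lam b ih => intro f; simp only [rename, permSize, ih]
  | app a b iha ihb => intro f; simp only [rename, permSize, iha, ihb]

theorem StepR.permSize_lt {r : Rule} {t t' : Lam} (hst : StepR r t t') (hr : r ≠ .beta) :
    permSize t' < permSize t := by
  induction hst with
  | beta M N => exact absurd rfl hr
  | delta M N =>
    have := two_le_permSize N
    simp only [permSize, swap01, shift, permSize_rename]
    nlinarith
  | gamma M N P =>
    have hN := two_le_permSize N
    have hP := two_le_permSize P
    simp only [permSize, shift, permSize_rename]
    nlinarith
  | assoc M N P =>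
    have hM := two_le_permSize M
    have hP := two_le_permSize P
    simp only [permSize, shift, permSize_rename]
    nlinarith
  | appL N _ ih =>
    exact Nat.mul_lt_mul_of_pos_right (ih hr) (by have := two_le_permSize N; omega)
  | appR M _ ih =>
    exact Nat.mul_lt_mul_of_pos_left (ih hr) (by have := two_le_permSize M; omega)
  | under _ ih => exact Nat.succ_lt_succ (ih hr)

theorem WTyped.sn {Γ : WCtx} {A : WTy} {n : ℕ} : ∀ {t : Lam}, WTyped t Γ A n → SN Step t := by
  induction n using Nat.strong_induction_on with
  | _ n ihn =>
    intro t
    induction hp : permSize t using Nat.strong_induction_on generalizing t with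
    | _ p ihp =>
      intro ht
      refine ⟨_, ?_⟩
      rintro t' ⟨r, hst⟩
      by_cases hr : r = .beta
      · obtain ⟨n', hn', ht'⟩ := hst.exists_wTyped_lt hr ht
        exact ihn n' hn' ht'
      · exact ihp _ (hp ▸ hst.permSize_lt hr) rfl (hst.wTyped_of_ne_beta hr ht)

/-! ### System 𝒟 terms have weighted types -/

/-- The term has some weighted type in some context. -/
def WTypable (t : Lam) : Prop := ∃ Γ A n, WTyped t Γ A n

/-- A variable applied to terms with weighted types. -/
inductive Neutral : Lam → Prop
  | var (n : ℕ) : Neutral (var n)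
  | app {t u : Lam} : Neutral t → WTypable u → Neutral (app t u)

theorem Neutral.exists_wTyped {t : Lam} (h : Neutral t) : ∀ A, ∃ Γ n, WTyped t Γ A n := by
  induction h with
  | var k => intro A; exact ⟨fun _ => {(A, 0)}, 0, 0, le_rfl, rfl⟩
  | app _ hu ih =>
    intro A
    obtain ⟨Δ, B, k, hB⟩ := hu
    obtain ⟨Γ, n, hn⟩ := ih (.arrow [] A)
    exact ⟨fun i => Γ i ∪ Δ i, n + k + 1, [], n, k,
      hn.weaken (.of_subset fun i => Set.subset_union_left),
      ⟨B, hB.weaken (.of_subset fun i => Set.subset_union_right)⟩, le_rfl⟩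

/-- `HeadExp t t'`: `t'` is obtained from `t` by expansion of a head redex whose argument has a
weighted type. -/
inductive HeadExp : Lam → Lam → Prop
  | beta (M : Lam) {N : Lam} : WTypable N → HeadExp (subst M 0 N) (app (lam M) N)
  | app {t t' : Lam} (u : Lam) : HeadExp t t' → HeadExp (app t u) (app t' u)

theorem HeadExp.exists_wTyped {t t' : Lam} (h : HeadExp t t') :
    ∀ {Γ : WCtx} {A : WTy} {n : ℕ}, WTyped t Γ A n →
      ∃ Δ n', (∀ i, Γ i ⊆ Δ i) ∧ WTyped t' Δ A n' := by
  induction h with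
  | beta M hN =>
    intro Γ A n ht
    obtain ⟨Δ, B, k, hB⟩ := hN
    obtain ⟨n', hn'⟩ := WTyped.expand (Γ := fun i => Γ i ∪ Δ i)
      (ht.weaken (.of_subset fun i => Set.subset_union_left))
      (hB.weaken (.of_subset fun i => Set.subset_union_right))
    exact ⟨_, n', fun i => Set.subset_union_left, hn'⟩
  | app u _ ih =>
    rintro Γ A n ⟨L, m, s, hM, hN, -⟩
    obtain ⟨Δ, m', hΔ, hM'⟩ := ih hM
    exact ⟨Δ, m' + s + 1, hΔ, L, m', s, hM',
      hN.imp fun _ _ => WTyped.weaken (.of_subset hΔ), le_rfl⟩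

/-- Reducibility interpretation of the types of system 𝒟. -/
def Red : Ty → Lam → Prop
  | .atom _, t => WTypable t
  | .arrow A B, t => ∀ u, Red A u → Red B (app t u)
  | .inter A B, t => Red A t ∧ Red B t

theorem Red.of_headExp {A : Ty} : ∀ {t t' : Lam}, HeadExp t t' → Red A t → Red A t' := by
  induction A with
  | atom _ =>
    rintro t t' h ⟨Γ, A, n, ht⟩
    obtain ⟨Δ, n', -, ht'⟩ := h.exists_wTyped ht
    exact ⟨Δ, A, n', ht'⟩
  | arrow A B _ ihB => intro t t' h ht u hu; exact ihB (h.app u) (ht u hu)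
  | inter A B ihA ihB => intro t t' h ht; exact ⟨ihA h ht.1, ihB h ht.2⟩

theorem red_neutral_and_wTypable (A : Ty) :
    (∀ t, Neutral t → Red A t) ∧ ∀ t, Red A t → WTypable t := by
  induction A with
  | atom _ =>
    refine ⟨fun t ht => ?_, fun t => id⟩
    obtain ⟨Γ, n, h⟩ := ht.exists_wTyped .atom
    exact ⟨Γ, .atom, n, h⟩
  | arrow A B ihA ihB =>
    refine ⟨fun t ht u hu => ihB.1 _ (ht.app (ihA.2 u hu)), fun t ht => ?_⟩
    obtain ⟨Γ, C, n, L, m, s, h, -⟩ := ihB.2 _ (ht (var 0) (ihA.1 _ (.var 0)))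
    exact ⟨Γ, _, m, h⟩
  | inter A B ihA ihB =>
    exact ⟨fun t ht => ⟨ihA.1 t ht, ihB.1 t ht⟩, fun t ht => ihA.2 t ht.1⟩

theorem Typed.red {Γ : List Ty} {t : Lam} {A : Ty} (h : Typed Γ t A) :
    ∀ σ : ℕ → Lam, (∀ i B, Γ[i]? = some B → Red B (σ i)) → Red A (psubst σ t) := by
  induction h with
  | var hn => intro σ hσ; exact hσ _ _ hn
  | app _ _ ihM ihN => intro σ hσ; exact ihM σ hσ _ (ihN σ hσ)
  | lam _ ih =>
    intro σ hσ u hu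
    refine Red.of_headExp (.beta _ ((red_neutral_and_wTypable _).2 u hu)) ?_
    rw [subst_psubst_up]
    refine ih _ fun i B hi => ?_
    cases i with
    | zero =>
      simp only [List.getElem?_cons_zero, Option.some.injEq] at hi
      exact hi ▸ hu
    | succ i => exact hσ i B (by simpa using hi)
  | interI _ _ ihA ihB => intro σ hσ; exact ⟨ihA σ hσ, ihB σ hσ⟩
  | interE1 _ ih => intro σ hσ; exact (ih σ hσ).1
  | interE2 _ ih => intro σ hσ; exact (ih σ hσ).2

theorem Typable.wTypable {t : Lam} (h : Typable t) : WTypable t := by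
  obtain ⟨Γ, A, ht⟩ := h
  have := ht.red var fun i B _ => (red_neutral_and_wTypable B).1 _ (.var i)
  rw [psubst_var] at this
  exact (red_neutral_and_wTypable A).2 t this

end Lam

open Lam in
/-- Every λ-term typable in system 𝒟 is strongly normalizing for
the combined reduction by β, δ, γ and assoc. -/
theorem typable_sn (t : Lam) (h : Typable t) : SN Step t := by
  obtain ⟨Γ, A, n, ht⟩ := h.wTypable
  exact ht.sn
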